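/- Let $d\ge 1$ and $\alpha\in(0,\min(2,d))$. There exists a constant $C>0$, depending only on $d$ and $\alpha$, such that for all $t>0$: $\sup_{x\in Q}\; \|G_d(t,x,\cdot)\|_{(\alpha)}^2 \le C\, t^{-\alpha/2}$. -/

import Mathlib

open MeasureTheory

/-- `φ_j(ξ) = √2 sin(jπξ)`. -/
noncomputable def phiF (j : ℕ) (ξ : ℝ) : ℝ := Real.sqrt 2 * Real.sin ((j : ℝ) * Real.pi * ξ)

/-- Green function of the heat operator on `[0,1]` with homogeneous
Dirichlet boundary conditions: `G(t,x,y) = ∑_{j≥1} e^{-j²π²t} φ_j(x) φ_j(y)`. -/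
noncomputable def G (t x y : ℝ) : ℝ :=
  ∑' j : ℕ, Real.exp (-((j : ℝ) + 1) ^ 2 * Real.pi ^ 2 * t) * phiF (j + 1) x * phiF (j + 1) y

/-- The cube `Q = [0,1]^d`. -/
def Q (d : ℕ) : Set (EuclideanSpace ℝ (Fin d)) := {x | ∀ i, x i ∈ Set.Icc (0 : ℝ) 1}

/-- `G_d(t,x,y) = ∏_i G(t,x_i,y_i)` on `Q = [0,1]^d`. -/
noncomputable def Gd (d : ℕ) (t : ℝ) (x y : EuclideanSpace ℝ (Fin d)) : ℝ :=
  ∏ i, G t (x i) (y i)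

/-- `‖φ‖_{(α)}² = ∫_Q ∫_Q |φ(y)| |y-z|^{-α} |φ(z)| dy dz`. -/
noncomputable def normAlphaSq (d : ℕ) (α : ℝ) (f : EuclideanSpace ℝ (Fin d) → ℝ) : ℝ :=
  ∫ y in Q d, ∫ z in Q d, |f y| * ‖y - z‖ ^ (-α) * |f z|

open HurwitzZeta Real

lemma cosKernel_nonneg' (a : ℝ) {t : ℝ} (ht : 0 < t) : 0 ≤ cosKernel a t := by
  have h := evenKernel_functional_equation a (1 / t)
  have h1 := (hasSum_int_evenKernel a (t := 1 / t) (by positivity)).nonneg (fun _ => (exp_pos _).le)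
  rw [one_div_one_div] at h
  rw [h] at h1
  by_contra hc
  push Not at hc
  have : (0:ℝ) < 1 / (1 / t) ^ (1 / 2 : ℝ) := by positivity
  nlinarith [mul_pos_of_neg_of_neg (neg_lt_zero.2 this) hc]

/-- Neumann heat kernel. -/
noncomputable def KN (t x y : ℝ) : ℝ :=
  (cosKernel ((x - y) / 2 : ℝ) (π * t) + cosKernel ((x + y) / 2 : ℝ) (π * t)) / 2

lemma hasSum_KN {t : ℝ} (ht : 0 < t) (x y : ℝ) :
    HasSum (fun j : ℕ => 2 * exp (-((j : ℝ) + 1) ^ 2 * π ^ 2 * t) *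
      (cos ((j + 1) * π * x) * cos ((j + 1) * π * y))) (KN t x y - 1) := by
  have hp : 0 < π * t := by positivity
  have h := ((hasSum_nat_cosKernel₀ ((x - y) / 2) hp).add
    (hasSum_nat_cosKernel₀ ((x + y) / 2) hp)).div_const 2
  convert! h using 1
  · ext j
    have e1 : 2 * π * ((x - y) / 2) * ((j : ℝ) + 1) = (j + 1) * π * x - (j + 1) * π * y := by ring
    have e2 : 2 * π * ((x + y) / 2) * ((j : ℝ) + 1) = (j + 1) * π * x + (j + 1) * π * y := by ring
    have e3 : -π * ((j : ℝ) + 1) ^ 2 * (π * t) = -((j : ℝ) + 1) ^ 2 * π ^ 2 * t := by ring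
    rw [e1, e2, e3, cos_sub, cos_add]; ring
  · unfold KN; ring

lemma hasSum_G {t : ℝ} (ht : 0 < t) (x y : ℝ) :
    HasSum (fun j : ℕ => exp (-((j : ℝ) + 1) ^ 2 * π ^ 2 * t) * phiF (j + 1) x * phiF (j + 1) y)
      ((cosKernel ((x - y) / 2 : ℝ) (π * t) - cosKernel ((x + y) / 2 : ℝ) (π * t)) / 2) := by
  have hp : 0 < π * t := by positivity
  have h := ((hasSum_nat_cosKernel₀ ((x - y) / 2) hp).sub
    (hasSum_nat_cosKernel₀ ((x + y) / 2) hp)).div_const 2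
  convert! h using 1
  · ext j
    have e1 : 2 * π * ((x - y) / 2) * ((j : ℝ) + 1) = (j + 1) * π * x - (j + 1) * π * y := by ring
    have e2 : 2 * π * ((x + y) / 2) * ((j : ℝ) + 1) = (j + 1) * π * x + (j + 1) * π * y := by ring
    have e3 : -π * ((j : ℝ) + 1) ^ 2 * (π * t) = -((j : ℝ) + 1) ^ 2 * π ^ 2 * t := by ring
    have e4 : √2 * √2 = 2 := by norm_num
    rw [e1, e2, e3, cos_sub, cos_add]
    unfold phiF
    push_cast
    linear_combination (exp (-((j : ℝ) + 1) ^ 2 * π ^ 2 * t) * sin ((j + 1) * π * x)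
      * sin ((j + 1) * π * y)) * e4
  · ring

lemma abs_G_le_KN {t : ℝ} (ht : 0 < t) (x y : ℝ) : |G t x y| ≤ KN t x y := by
  have hp : 0 < π * t := by positivity
  rw [G, (hasSum_G ht x y).tsum_eq, KN]
  have h1 := cosKernel_nonneg' ((x - y) / 2) hp
  have h2 := cosKernel_nonneg' ((x + y) / 2) hp
  rw [abs_le]
  constructor <;> linarith

lemma KN_nonneg {t : ℝ} (ht : 0 < t) (x y : ℝ) : 0 ≤ KN t x y :=
  (abs_nonneg _).trans (abs_G_le_KN ht x y)

lemma summable_e {t : ℝ} (ht : 0 < t) :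
    Summable (fun j : ℕ => 2 * exp (-((j : ℝ) + 1) ^ 2 * π ^ 2 * t)) := by
  simpa using (hasSum_KN ht 0 0).summable

lemma norm_term_le {t : ℝ} (x y : ℝ) (j : ℕ) :
    ‖2 * exp (-((j : ℝ) + 1) ^ 2 * π ^ 2 * t) *
      (cos ((j + 1) * π * x) * cos ((j + 1) * π * y))‖ ≤
      2 * exp (-((j : ℝ) + 1) ^ 2 * π ^ 2 * t) := by
  rw [norm_mul, Real.norm_eq_abs, Real.norm_eq_abs, abs_of_pos (by positivity), abs_mul]
  have h1 := abs_cos_le_one ((j + 1) * π * x)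
  have h2 := abs_cos_le_one ((j + 1) * π * y)
  have := mul_le_one₀ h1 (abs_nonneg _) h2
  exact mul_le_of_le_one_right (by positivity) this

lemma KN_eq {t : ℝ} (ht : 0 < t) (x : ℝ) : KN t x = fun y => 1 + ∑' j : ℕ,
    2 * exp (-((j : ℝ) + 1) ^ 2 * π ^ 2 * t) * (cos ((j + 1) * π * x) * cos ((j + 1) * π * y)) := by
  ext y
  rw [(hasSum_KN ht x y).tsum_eq]; ring

lemma continuous_KN {t : ℝ} (ht : 0 < t) (x : ℝ) : Continuous (KN t x) := by
  rw [KN_eq ht x]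
  refine continuous_const.add (continuous_tsum (fun j => ?_) (summable_e ht)
    (fun j y => norm_term_le x y j))
  fun_prop

lemma integrableOn_KN {t : ℝ} (ht : 0 < t) (x : ℝ) : IntegrableOn (KN t x) (Set.Icc 0 1) :=
  (continuous_KN ht x).continuousOn.integrableOn_compact isCompact_Icc

lemma integral_KN {t : ℝ} (ht : 0 < t) (x : ℝ) : ∫ y in Set.Icc (0:ℝ) 1, KN t x y = 1 := by
  have hs : ∫ y in (0:ℝ)..1, (KN t x y - 1) = 0 := by
    have h := intervalIntegral.hasSum_integral_of_dominated_convergence (a := 0) (b := 1)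
      (μ := volume) (F := fun (j : ℕ) (y : ℝ) => 2 * exp (-((j : ℝ) + 1) ^ 2 * π ^ 2 * t) *
        (cos ((j + 1) * π * x) * cos ((j + 1) * π * y))) (f := fun y => KN t x y - 1)
      (fun j _ => 2 * exp (-((j : ℝ) + 1) ^ 2 * π ^ 2 * t))
      (fun j => (by fun_prop : Continuous _).aestronglyMeasurable)
      (fun j => Filter.Eventually.of_forall fun y _ => norm_term_le x y j)
      (Filter.Eventually.of_forall fun y _ => summable_e ht)
      (by simp)
      (Filter.Eventually.of_forall fun y _ => hasSum_KN ht x y)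
    refine h.unique ?_
    convert hasSum_zero with j
    have hne : ((j : ℝ) + 1) * π ≠ 0 := by positivity
    have : sin (((j : ℝ) + 1) * π) = 0 := by
      have := sin_nat_mul_pi (j + 1)
      push_cast at this
      exact this
    simp only [intervalIntegral.integral_const_mul]
    rw [intervalIntegral.integral_comp_mul_left _ hne]
    simp [this]
  rw [intervalIntegral.integral_sub ((continuous_KN ht x).intervalIntegrable _ _) (by simp),
    intervalIntegral.integral_of_le zero_le_one, ← integral_Icc_eq_integral_Ioc] at hs
  simp at hs
  linarith

lemma abs_G_le {t : ℝ} (ht : 0 < t) (x y : ℝ) : |G t x y| ≤ t ^ (-(1 / 2) : ℝ) := by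
  have hb : 0 < π ^ 2 * t := by positivity
  have hanti : ∀ n : ℕ, ∑ j ∈ Finset.range n, exp (-((j : ℝ) + 1) ^ 2 * π ^ 2 * t) ≤
      √(π / (π ^ 2 * t)) / 2 := by
    intro n
    have ha : AntitoneOn (fun s : ℝ => exp (-(π ^ 2 * t) * s ^ 2)) (Set.Icc 0 (0 + (n : ℝ))) := by
      intro a ha b hb' hab
      simp only
      apply exp_le_exp.2
      have : a ^ 2 ≤ b ^ 2 := pow_le_pow_left₀ ha.1 hab 2
      nlinarith
    have h := ha.sum_le_integral
    rw [← integral_gaussian_Ioi (π ^ 2 * t)]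
    refine le_trans (le_of_eq ?_) (h.trans ?_)
    · refine Finset.sum_congr rfl fun j _ => ?_
      push_cast
      ring_nf
    · rw [intervalIntegral.integral_of_le (by positivity)]
      exact setIntegral_mono_set (integrable_exp_neg_mul_sq hb).integrableOn
        (Filter.Eventually.of_forall fun _ => (exp_pos _).le)
        (Filter.Eventually.of_forall fun s hs => hs.1)
  have hle : ∑' j : ℕ, 2 * exp (-((j : ℝ) + 1) ^ 2 * π ^ 2 * t) ≤ √(π / (π ^ 2 * t)) := by
    refine Real.tsum_le_of_sum_range_le (fun _ => by positivity) fun n => ?_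
    rw [← Finset.mul_sum]
    linarith [hanti n]
  have hfin : √(π / (π ^ 2 * t)) ≤ t ^ (-(1 / 2) : ℝ) := by
    rw [rpow_neg ht.le, ← sqrt_eq_rpow, ← sqrt_inv]
    apply sqrt_le_sqrt
    rw [pow_two, mul_assoc, div_mul_cancel_left₀ pi_ne_zero]
    apply inv_anti₀ ht
    nlinarith [pi_gt_three]
  refine le_trans ?_ (hle.trans hfin)
  rw [← Real.norm_eq_abs, G]
  refine tsum_of_norm_bounded (summable_e ht).hasSum fun j => ?_
  unfold phiF
  have e4 : √2 * √2 = 2 := by norm_num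
  have h1 := abs_sin_le_one (((j + 1 : ℕ) : ℝ) * π * x)
  have h2 := abs_sin_le_one (((j + 1 : ℕ) : ℝ) * π * y)
  have := mul_le_one₀ h1 (abs_nonneg _) h2
  rw [Real.norm_eq_abs, abs_mul, abs_mul, abs_mul, abs_mul, abs_of_pos (exp_pos _),
    abs_of_pos (by positivity : (0:ℝ) < √2)]
  calc _ = 2 * exp (-((j : ℝ) + 1) ^ 2 * π ^ 2 * t) * (|sin (((j + 1 : ℕ) : ℝ) * π * x)| *
        |sin (((j + 1 : ℕ) : ℝ) * π * y)|) := by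
        linear_combination (exp (-((j : ℝ) + 1) ^ 2 * π ^ 2 * t) * (|sin (((j + 1 : ℕ) : ℝ) * π * x)| *
        |sin (((j + 1 : ℕ) : ℝ) * π * y)|)) * e4
    _ ≤ _ := mul_le_of_le_one_right (by positivity) this

lemma Q_eq (d : ℕ) : (@WithLp.toLp 2 (Fin d → ℝ)) ⁻¹' (Q d) =
    Set.univ.pi fun _ => Set.Icc (0:ℝ) 1 := by
  ext v; simp [Q, Pi.le_def, forall_and]

lemma measurableSet_Q (d : ℕ) : MeasurableSet (Q d) := by
  have : Q d = ⋂ i, (fun x : EuclideanSpace ℝ (Fin d) => x i) ⁻¹' Set.Icc (0:ℝ) 1 := by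
    ext v; simp [Q]
  rw [this]
  refine MeasurableSet.iInter fun i => measurableSet_Icc.preimage ?_
  exact (by fun_prop : Continuous fun x : EuclideanSpace ℝ (Fin d) => x i).measurable

lemma integrableOn_prod {d : ℕ} {t : ℝ} (ht : 0 < t) (x : EuclideanSpace ℝ (Fin d)) :
    IntegrableOn (fun z : EuclideanSpace ℝ (Fin d) => ∏ i, KN t (x i) (z i)) (Q d) := by
  rw [← (PiLp.volume_preserving_toLp (Fin d)).integrableOn_comp_preimage
    (MeasurableEquiv.toLp 2 _).measurableEmbedding, Q_eq, IntegrableOn, volume_pi,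
    Measure.restrict_pi_pi]
  exact Integrable.fintype_prod (f := fun i => KN t (x i)) (fun i => integrableOn_KN ht (x i))

lemma integral_prod {d : ℕ} {t : ℝ} (ht : 0 < t) (x : EuclideanSpace ℝ (Fin d)) :
    ∫ z in Q d, ∏ i, KN t (x i) (z i) = 1 := by
  rw [← (PiLp.volume_preserving_toLp (Fin d)).setIntegral_preimage_emb
    (MeasurableEquiv.toLp 2 _).measurableEmbedding, Q_eq, volume_pi, Measure.restrict_pi_pi]
  refine (integral_fintype_prod_eq_prod (fun i => KN t (x i))).trans ?_
  simp [integral_KN ht]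

lemma radial_aux {d : ℕ} (hd : 1 ≤ d) {α r : ℝ} (hr : 0 < r) :
    Set.EqOn (fun y : ℝ => y ^ (d - 1) • (Set.Iio r).indicator (fun s => s ^ (-α)) y)
      ((Set.Iio r).indicator (fun y => y ^ ((d : ℝ) - 1 - α))) (Set.Ioi 0) := by
  intro y hy
  have hy : 0 < y := hy
  by_cases h : y < r
  · simp only [Set.indicator, Set.mem_Iio, h, if_true, smul_eq_mul]
    rw [← rpow_natCast, ← rpow_add hy]
    congr 1
    push_cast [hd]; ring
  · simp [Set.indicator, h]

lemma ball_integrable {d : ℕ} (hd : 1 ≤ d) {α r : ℝ} (hα : α < d) (hr : 0 < r) :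
    Integrable (fun w : EuclideanSpace ℝ (Fin d) => (Set.Iio r).indicator (fun s => s ^ (-α)) ‖w‖)
    ∧ ∫ w : EuclideanSpace ℝ (Fin d), (Set.Iio r).indicator (fun s => s ^ (-α)) ‖w‖ =
      (d * volume.real (Metric.ball (0 : EuclideanSpace ℝ (Fin d)) 1) / (d - α)) *
        r ^ ((d : ℝ) - α) := by
  haveI : Nonempty (Fin d) := ⟨⟨0, hd⟩⟩
  have e : Set.Iio r ∩ Set.Ioi 0 = Set.Ioo 0 r := by ext; simp [and_comm]
  constructor
  · rw [integrable_fun_norm_addHaar, finrank_euclideanSpace_fin,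
      integrableOn_congr_fun (radial_aux hd hr) measurableSet_Ioi, IntegrableOn,
      integrable_indicator_iff measurableSet_Iio, IntegrableOn,
      Measure.restrict_restrict measurableSet_Iio, e]
    have := intervalIntegral.intervalIntegrable_rpow' (a := 0) (b := r)
      (r := (d : ℝ) - 1 - α) (by linarith)
    exact ((intervalIntegrable_iff_integrableOn_Ioo_of_le hr.le).1 this)
  · rw [integral_fun_norm_addHaar, finrank_euclideanSpace_fin,
      setIntegral_congr_fun measurableSet_Ioi (radial_aux hd hr),
      integral_indicator measurableSet_Iio, Measure.restrict_restrict measurableSet_Iio, e,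
      ← integral_Ioc_eq_integral_Ioo, ← intervalIntegral.integral_of_le hr.le,
      integral_rpow (Or.inl (by linarith))]
    rw [show (d : ℝ) - 1 - α + 1 = d - α by ring, zero_rpow (by linarith)]
    simp
    ring

theorem stmt_3 (d : ℕ) (hd : 1 ≤ d) (α : ℝ) (hα : α ∈ Set.Ioo (0 : ℝ) (min 2 (d : ℝ))) :
    ∃ C : ℝ, 0 < C ∧ ∀ t : ℝ, 0 < t → ∀ x ∈ Q d,
      normAlphaSq d α (fun y => Gd d t x y) ≤ C * t ^ (-α / 2) := by
  have hαd : α < d := hα.2.trans_le (min_le_right _ _)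
  set A : ℝ := d * volume.real (Metric.ball (0 : EuclideanSpace ℝ (Fin d)) 1) / (d - α) with hA
  have hA0 : 0 ≤ A := div_nonneg (by positivity) (by linarith)
  refine ⟨1 + A, by positivity, fun t ht x _ => ?_⟩
  have hr : 0 < √t := by positivity
  set P : EuclideanSpace ℝ (Fin d) → ℝ := fun z => ∏ i, KN t (x i) (z i) with hP
  set B : EuclideanSpace ℝ (Fin d) → ℝ :=
    fun w => (Set.Iio √t).indicator (fun s => s ^ (-α)) ‖w‖ with hB
  obtain ⟨hBi, hBv⟩ := ball_integrable hd hαd hr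
  rw [← hA] at hBv
  have hPi := integrableOn_prod ht x
  have hPv := integral_prod ht x
  have hfP : ∀ z, |Gd d t x z| ≤ P z := fun z => by
    rw [Gd, Finset.abs_prod]
    exact Finset.prod_le_prod (fun _ _ => abs_nonneg _) fun i _ => abs_G_le_KN ht _ _
  have hP0 : ∀ z, 0 ≤ P z := fun z => (abs_nonneg _).trans (hfP z)
  have hfM : ∀ z, |Gd d t x z| ≤ t ^ (-(d : ℝ) / 2) := fun z => by
    rw [Gd, Finset.abs_prod]
    refine (Finset.prod_le_prod (fun _ _ => abs_nonneg _) fun i _ => abs_G_le ht _ _).trans ?_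
    rw [Finset.prod_const, Finset.card_univ, Fintype.card_fin, ← rpow_natCast, ← rpow_mul ht.le]
    apply le_of_eq; congr 1; ring
  have hB0 : ∀ w, 0 ≤ B w := fun w =>
    Set.indicator_apply_nonneg (fun _ => rpow_nonneg (norm_nonneg _) _)
  have hM0 : 0 ≤ t ^ (-(d : ℝ) / 2) := by positivity
  have hT0 : 0 ≤ t ^ (-α / 2) := by positivity
  have hst : √t ^ (-α) = t ^ (-α / 2) := by
    rw [sqrt_eq_rpow, ← rpow_mul ht.le]; congr 1; ring
  have hJ : ∀ y, ∫ z in Q d, ‖y - z‖ ^ (-α) * |Gd d t x z| ≤ (1 + A) * t ^ (-α / 2) := by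
    intro y
    have hBi' : Integrable (fun z => B (y - z)) := hBi.comp_sub_left y
    calc _ ≤ ∫ z in Q d, (t ^ (-α / 2) * P z + t ^ (-(d : ℝ) / 2) * B (y - z)) := by
          refine integral_mono_of_nonneg (Filter.Eventually.of_forall fun z => by positivity)
            ((hPi.const_mul _).add (hBi'.integrableOn.const_mul _))
            (Filter.Eventually.of_forall fun z => ?_)
          simp only
          by_cases h : ‖y - z‖ < √t
          · have hb : B (y - z) = ‖y - z‖ ^ (-α) := by simp [hB, h]
            have h1 : ‖y - z‖ ^ (-α) * |Gd d t x z| ≤ ‖y - z‖ ^ (-α) * t ^ (-(d : ℝ) / 2) :=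
              mul_le_mul_of_nonneg_left (hfM z) (by positivity)
            have h2 := mul_nonneg hT0 (hP0 z)
            rw [hb]; linarith
          · have h1 : ‖y - z‖ ^ (-α) ≤ t ^ (-α / 2) := by
              rw [← hst]
              exact rpow_le_rpow_of_nonpos hr (not_lt.1 h) (by linarith [hα.1])
            have h2 := mul_nonneg hM0 (hB0 (y - z))
            have h3 := mul_le_mul h1 (hfP z) (abs_nonneg _) hT0
            linarith
      _ = t ^ (-α / 2) * 1 + t ^ (-(d : ℝ) / 2) * ∫ z in Q d, B (y - z) := by
          rw [integral_add (hPi.const_mul _) (hBi'.integrableOn.const_mul _),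
            integral_const_mul, integral_const_mul, hPv]
      _ ≤ t ^ (-α / 2) * 1 + t ^ (-(d : ℝ) / 2) * ∫ z, B (y - z) := by
          gcongr
          exact Filter.Eventually.of_forall fun z => hB0 _
          exact Measure.restrict_le_self
      _ = _ := by
          rw [integral_sub_left_eq_self B volume y, hBv, sqrt_eq_rpow, ← rpow_mul ht.le]
          have : t ^ (-α / 2) = t ^ (-(d : ℝ) / 2) * t ^ (1 / 2 * ((d : ℝ) - α)) := by
            rw [← rpow_add ht]; congr 1; ring
          linear_combination (-A) * this
  unfold normAlphaSq
  calc _ ≤ ∫ y in Q d, P y * ((1 + A) * t ^ (-α / 2)) := by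
        refine integral_mono_of_nonneg
          (Filter.Eventually.of_forall fun y => integral_nonneg fun z => by positivity)
          (hPi.mul_const _) (Filter.Eventually.of_forall fun y => ?_)
        simp only [mul_assoc]
        rw [integral_const_mul, ← mul_assoc (P y)]
        refine (mul_le_mul (hfP y) (hJ y) (integral_nonneg fun z => by positivity) (hP0 y)).trans ?_
        exact le_of_eq (by ring)
    _ = _ := by rw [integral_mul_const, hPv, one_mul]
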